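/- arXiv:1609.00039 — 3 statements merged into one kernel-verified Lean document; each statement's English description precedes it below -/
import Mathlib

section
/- Let f : ℝ² → ℝ be continuous, and suppose that for every smooth compactly supported φ : ℝ² → ℝ, ∫∫ f(x,y) (∂φ/∂x)(x,y) dx dy = 0 (i.e., ∂f/∂x = 0 in the distributional sense). Then f does not depend on its first variable: there exists a continuous function β : ℝ → ℝ such that f(x,y) = β(y) for all (x,y). -/
open MeasureTheory

/-- Distributional ∂/∂x of a test function (its classical partial derivative). -/
noncomputable def partialX (φ : ℝ × ℝ → ℝ) (p : ℝ × ℝ) : ℝ :=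
  deriv (fun x => φ (x, p.2)) p.1

open ContDiffBump Convolution Topology Filter

theorem partialX_comp_sub_left {g : ℝ × ℝ → ℝ} (hg : Differentiable ℝ g) (q p : ℝ × ℝ) :
    partialX (fun r => g (q - r)) p = -fderiv ℝ g (q - p) (1, 0) := by
  have hline : HasDerivAt (fun x : ℝ => q - (x, p.2)) (-(1, 0)) p.1 :=
    ((hasDerivAt_id p.1).prodMk (hasDerivAt_const p.1 p.2)).const_sub q
  have := (hg (q - p)).hasFDerivAt.comp_hasDerivAt p.1 hline
  rw [map_neg] at this
  exact this.deriv

/-- Mollifying a continuous function with vanishing weak `x`-derivative gives a function that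
does not depend on `x`. -/
theorem convolution_eq_of_integral_mul_partialX_eq_zero {f g : ℝ × ℝ → ℝ} (hf : Continuous f)
    (h : ∀ φ : ℝ × ℝ → ℝ, ContDiff ℝ (⊤ : ℕ∞) φ → HasCompactSupport φ →
      ∫ p, f p * partialX φ p = 0)
    (hg : ContDiff ℝ (⊤ : ℕ∞) g) (hgc : HasCompactSupport g) (x x' y : ℝ) :
    (g ⋆[ContinuousLinearMap.lsmul ℝ ℝ] f) (x, y) =
      (g ⋆[ContinuousLinearMap.lsmul ℝ ℝ] f) (x', y) := by
  have hg1 : ContDiff ℝ 1 g := hg.of_le (by exact_mod_cast le_top)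
  have hgd : Differentiable ℝ g := hg1.differentiable one_ne_zero
  have hderiv : ∀ s : ℝ,
      HasDerivAt (fun t : ℝ => (g ⋆[ContinuousLinearMap.lsmul ℝ ℝ] f) (t, y)) 0 s := by
    intro s
    have hline : HasDerivAt (fun t : ℝ => (t, y)) (1, 0) s :=
      (hasDerivAt_id s).prodMk (hasDerivAt_const s y)
    have hconv := (hgc.hasFDerivAt_convolution_left (μ := volume) (ContinuousLinearMap.lsmul ℝ ℝ)
      hg1 hf.locallyIntegrable (s, y)).comp_hasDerivAt s hline
    refine hconv.congr_deriv ?_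
    have htest := h (fun r => g ((s, y) - r)) (hg.comp (contDiff_const.sub contDiff_id))
      (hgc.comp_homeomorph (Homeomorph.subLeft (s, y)))
    simp only [partialX_comp_sub_left hgd, mul_neg, integral_neg, neg_eq_zero] at htest
    rw [← convolution_flip, ContinuousLinearMap.precompL, ContinuousLinearMap.flip_flip,
      convolution_precompR_apply _ hf.locallyIntegrable (hgc.fderiv (𝕜 := ℝ))
        (hg1.continuous_fderiv one_ne_zero)]
    simpa [convolution_def, mul_comm] using htest
  exact is_const_of_deriv_eq_zero (fun s => (hderiv s).differentiableAt)
    (fun s => (hderiv s).deriv) x x'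

theorem stmt_2 (f : ℝ × ℝ → ℝ) (hf : Continuous f)
    (h : ∀ φ : ℝ × ℝ → ℝ, ContDiff ℝ (⊤ : ℕ∞) φ → HasCompactSupport φ →
      ∫ p, f p * partialX φ p = 0) :
    ∃ β : ℝ → ℝ, Continuous β ∧ ∀ x y : ℝ, f (x, y) = β y := by
  refine ⟨fun y => f (0, y), by fun_prop, fun x y => ?_⟩
  let φ : ℕ → ContDiffBump (0 : ℝ × ℝ) := fun n =>
    { rIn := 1 / ((n : ℝ) + 1)
      rOut := 2 * (1 / ((n : ℝ) + 1))
      rIn_pos := by positivity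
      rIn_lt_rOut := lt_two_mul_self (by positivity) }
  have hφ : Tendsto (fun n => (φ n).rOut) atTop (𝓝 0) := by
    simpa [φ] using tendsto_one_div_add_atTop_nhds_zero_nat.const_mul (2 : ℝ)
  have hlim := fun p : ℝ × ℝ =>
    convolution_tendsto_right_of_continuous (μ := volume) hφ hf p
  refine tendsto_nhds_unique (hlim (x, y)) ((hlim (0, y)).congr fun n => ?_)
  exact convolution_eq_of_integral_mul_partialX_eq_zero hf h (φ n).contDiff_normed
    (φ n).hasCompactSupport_normed 0 x y
end

section
/- Let f : ℝ² → ℝ be continuous and suppose that for every smooth compactly supported test function φ : ℝ² → ℝ one has ∫∫ f(x,y) (∂²φ/∂x∂y)(x,y) dx dy = 0 (i.e., ∂²f/∂x∂y = 0 distributionally). Then there exist continuous functions α, β : ℝ → ℝ such that f(x,y) = α(x) + β(y) for all (x,y) ∈ ℝ². -/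
open MeasureTheory

/-- Classical mixed partial derivative ∂²φ/∂x∂y of a test function. -/
noncomputable def partialXY (φ : ℝ × ℝ → ℝ) (p : ℝ × ℝ) : ℝ :=
  deriv (fun y => deriv (fun x => φ (x, y)) p.1) p.2

open Filter Topology Convolution in
/-- The **du Bois-Reymond lemma** for continuous functions: a continuous function with vanishing
distributional derivative is constant. -/
theorem eq_of_forall_integral_mul_deriv_eq_zero {g : ℝ → ℝ} (hg : Continuous g)
    (h : ∀ u : ℝ → ℝ, ContDiff ℝ (⊤ : ℕ∞) u → HasCompactSupport u → ∫ t, g t * deriv u t = 0)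
    (a b : ℝ) : g a = g b := by
  have mollified_eq (φ : ContDiffBump (0 : ℝ)) :
      (φ.normed volume ⋆[ContinuousLinearMap.lsmul ℝ ℝ, volume] g) a =
        (φ.normed volume ⋆[ContinuousLinearMap.lsmul ℝ ℝ, volume] g) b := by
    set ρ : ℝ → ℝ := φ.normed volume with hρ
    have ρ_cont : Continuous ρ := φ.continuous_normed
    have ρ_supp : HasCompactSupport ρ := φ.hasCompactSupport_normed
    have conv_eq (c : ℝ) : (ρ ⋆[ContinuousLinearMap.lsmul ℝ ℝ, volume] g) c =
        ∫ t, g t * ρ (t - c) := by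
      rw [convolution_eq_swap]
      congr 1 with t
      rw [← neg_sub, hρ, φ.normed_neg]
      simp [mul_comm]
    have integrable_translate (c : ℝ) : Integrable fun t => g t * ρ (t - c) :=
      (hg.mul (by fun_prop)).integrable_of_hasCompactSupport
        (ρ_supp.comp_homeomorph (Homeomorph.subRight c)).mul_left
    set R : ℝ → ℝ := fun t => ∫ s in (0 : ℝ)..t, ρ s
    have R_deriv (t : ℝ) : HasDerivAt R (ρ t) t :=
      ρ_cont.integral_hasStrictDerivAt 0 t |>.hasDerivAt
    have R_smooth : ContDiff ℝ (⊤ : ℕ∞) R := by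
      rw [contDiff_infty_iff_deriv]
      refine ⟨fun t => (R_deriv t).differentiableAt, ?_⟩
      rw [show deriv R = ρ from funext fun t => (R_deriv t).deriv]
      exact φ.contDiff_normed
    have u_deriv (t : ℝ) :
        HasDerivAt (fun t => R (t - a) - R (t - b)) (ρ (t - a) - ρ (t - b)) t :=
      ((R_deriv (t - a)).comp_sub_const t a).sub ((R_deriv (t - b)).comp_sub_const t b)
    have u_supp : HasCompactSupport fun t => R (t - a) - R (t - b) := by
      refine HasCompactSupport.intro
        (isCompact_closedBall (0 : ℝ) (φ.rOut + |a| + |b|)) fun t ht => ?_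
      have ht : φ.rOut + |a| + |b| < |t| := by simpa using ht
      change (∫ s in (0 : ℝ)..(t - a), ρ s) - ∫ s in (0 : ℝ)..(t - b), ρ s = 0
      rw [intervalIntegral.integral_interval_sub_left (ρ_cont.intervalIntegrable _ _)
        (ρ_cont.intervalIntegrable _ _)]
      refine intervalIntegral.integral_zero_ae (ae_of_all _ fun s hs => ?_)
      rw [← Function.notMem_support, hρ, φ.support_normed_eq]
      have hs := Set.uIoc_subset_uIcc hs
      simp only [Metric.mem_ball, dist_zero_right, Real.norm_eq_abs, not_lt]
      rw [Set.mem_uIcc] at hs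
      grind
    have key := h (fun t => R (t - a) - R (t - b)) ((R_smooth.comp (by fun_prop)).sub (R_smooth.comp (by fun_prop))) u_supp
    simp only [fun t => (u_deriv t).deriv, mul_sub] at key
    rw [integral_sub (integrable_translate a) (integrable_translate b), sub_eq_zero] at key
    rw [conv_eq, conv_eq, key]
  let φ (n : ℕ) : ContDiffBump (0 : ℝ) :=
    ⟨1 / (n + 1) / 2, 1 / (n + 1), by positivity, half_lt_self (by positivity)⟩
  have φ_tendsto : Tendsto (fun n => (φ n).rOut) atTop (𝓝 0) :=
    tendsto_one_div_add_atTop_nhds_zero_nat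
  have mollify (c : ℝ) :=
    ContDiffBump.convolution_tendsto_right_of_continuous (μ := volume) φ_tendsto hg c
  refine tendsto_nhds_unique (mollify a) ?_
  simpa only [mollified_eq] using mollify b

theorem partialXY_mul (u v : ℝ → ℝ) (p : ℝ × ℝ) :
    partialXY (fun q => u q.1 * v q.2) p = deriv u p.1 * deriv v p.2 := by
  simp [partialXY, deriv_mul_const_field, deriv_const_mul_field]

theorem HasCompactSupport.mul_prod {u v : ℝ → ℝ} (hu : HasCompactSupport u)
    (hv : HasCompactSupport v) : HasCompactSupport fun p : ℝ × ℝ => u p.1 * v p.2 := by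
  refine HasCompactSupport.intro (hu.isCompact.prod hv.isCompact) fun p hp => ?_
  rw [Set.mem_prod, not_and_or] at hp
  rcases hp with hp | hp <;> simp [image_eq_zero_of_notMem_tsupport hp]

theorem continuous_integral_mul_right {f : ℝ × ℝ → ℝ} (hf : Continuous f) {w : ℝ → ℝ}
    (hw : Continuous w) (w_supp : HasCompactSupport w) :
    Continuous fun x => ∫ y, f (x, y) * w y := by
  rw [← continuousOn_univ]
  refine continuousOn_integral_of_compact_support w_supp.isCompact (by fun_prop) ?_
  intro x y _ hy
  simp [image_eq_zero_of_notMem_tsupport hy]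

theorem stmt_6 (f : ℝ × ℝ → ℝ) (hf : Continuous f)
    (h : ∀ φ : ℝ × ℝ → ℝ, ContDiff ℝ (⊤ : ℕ∞) φ → HasCompactSupport φ →
      ∫ p, f p * partialXY φ p = 0) :
    ∃ α β : ℝ → ℝ, Continuous α ∧ Continuous β ∧
      ∀ x y : ℝ, f (x, y) = α x + β y := by
  have slice_const (v : ℝ → ℝ) (hv : ContDiff ℝ (⊤ : ℕ∞) v) (v_supp : HasCompactSupport v)
      (x : ℝ) : ∫ y, f (x, y) * deriv v y = ∫ y, f (0, y) * deriv v y := by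
    have v'_cont : Continuous (deriv v) := hv.continuous_deriv (by simp)
    refine eq_of_forall_integral_mul_deriv_eq_zero
      (continuous_integral_mul_right hf v'_cont v_supp.deriv) (fun u hu u_supp => ?_) x 0
    have u'_cont : Continuous (deriv u) := hu.continuous_deriv (by simp)
    have key := h (fun q => u q.1 * v q.2)
      ((hu.comp contDiff_fst).mul (hv.comp contDiff_snd)) (u_supp.mul_prod v_supp)
    simp only [partialXY_mul] at key
    rw [Measure.volume_eq_prod, integral_prod] at key
    · rw [← key]
      congr 1 with s
      rw [← integral_mul_const]
      congr 1 with y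
      ring
    · exact (hf.mul (by fun_prop)).integrable_of_hasCompactSupport
        (u_supp.deriv.mul_prod v_supp.deriv).mul_left
  have increment_const (x y : ℝ) : f (x, y) - f (0, y) = f (x, 0) - f (0, 0) := by
    refine eq_of_forall_integral_mul_deriv_eq_zero (g := fun y => f (x, y) - f (0, y))
      (by fun_prop) (fun v hv v_supp => ?_) y 0
    have v'_cont : Continuous (deriv v) := hv.continuous_deriv (by simp)
    have slice_integrable (c : ℝ) : Integrable fun y => f (c, y) * deriv v y :=
      (Continuous.mul (by fun_prop) v'_cont).integrable_of_hasCompactSupport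
        v_supp.deriv.mul_left
    simp only [sub_mul]
    rw [integral_sub (slice_integrable x) (slice_integrable 0), slice_const v hv v_supp, sub_self]
  exact ⟨fun x => f (x, 0) - f (0, 0), fun y => f (0, y), by fun_prop, by fun_prop,
    fun x y => by linarith [increment_const x y]⟩
end

section
/- Let f : ℝ² → ℝ be a continuous function such that (∂²f/∂x∂y = 0 distributionally) and suppose additionally that f² also satisfies ∂²(f²)/∂x∂y = 0 distributionally. Writing f(x,y) = α(x) + β(y) (which exists by the splitting of distributional wave-equation solutions), the product α(x)β(y) also splits additively: ∂²(αβ)/∂x∂y = 0 distributionally, and consequently either α is constant or β is constant. -/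
open MeasureTheory

def IsTest (φ : ℝ × ℝ → ℝ) : Prop := ContDiff ℝ (⊤ : ℕ∞) φ ∧ HasCompactSupport φ

/-- The difference of two translates of a smooth compactly supported function on the line
has a smooth compactly supported antiderivative. -/
theorem exists_antideriv_sub_translate {ρ : ℝ → ℝ} (hρ : ContDiff ℝ (⊤ : ℕ∞) ρ)
    (hc : HasCompactSupport ρ) (a b : ℝ) :
    ∃ A : ℝ → ℝ, ContDiff ℝ (⊤ : ℕ∞) A ∧ HasCompactSupport A ∧
      ∀ x, deriv A x = ρ (a - x) - ρ (b - x) := by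
  have hR : ∀ x, HasDerivAt (fun u => ∫ t in (0 : ℝ)..u, ρ t) (ρ x) x := fun x =>
    intervalIntegral.integral_hasDerivAt_right (hρ.continuous.intervalIntegrable _ _)
      (hρ.continuous.stronglyMeasurableAtFilter _ _) hρ.continuous.continuousAt
  have hA : ∀ x, HasDerivAt
      (fun x => (∫ t in (0 : ℝ)..(b - x), ρ t) - ∫ t in (0 : ℝ)..(a - x), ρ t)
      (ρ (a - x) - ρ (b - x)) x := by
    intro x
    have h := ((hR (b - x)).comp_const_sub b x).sub ((hR (a - x)).comp_const_sub a x)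
    exact h.congr_deriv (by ring)
  refine ⟨_, ?_, ?_, fun x => (hA x).deriv⟩
  · rw [contDiff_infty_iff_deriv]
    refine ⟨fun x => (hA x).differentiableAt, ?_⟩
    rw [funext fun x => (hA x).deriv]
    fun_prop
  · obtain ⟨M, hM⟩ := hc.isCompact.isBounded.subset_closedBall 0
    have hz : ∀ t, M < |t| → ρ t = 0 := by
      intro t ht
      by_contra h
      have := hM (subset_tsupport ρ h)
      rw [mem_closedBall_zero_iff, Real.norm_eq_abs] at this
      linarith
    refine HasCompactSupport.intro
      (K := Set.Icc (min a b - M) (max a b + M)) isCompact_Icc fun x hx => ?_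
    rw [intervalIntegral.integral_interval_sub_left
      (hρ.continuous.intervalIntegrable _ _) (hρ.continuous.intervalIntegrable _ _)]
    refine intervalIntegral.integral_zero_ae (Filter.Eventually.of_forall fun t ht => hz t ?_)
    rw [Set.uIoc, Set.mem_Ioc] at ht
    rw [lt_abs]
    by_contra! h
    apply hx
    constructor
    · rcases min_cases a b with h1 | h1 <;> rcases max_cases (a - x) (b - x) with h2 | h2 <;>
        rcases min_cases (a - x) (b - x) with h3 | h3 <;> linarith
    · rcases max_cases a b with h1 | h1 <;> rcases max_cases (a - x) (b - x) with h2 | h2 <;>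
        rcases min_cases (a - x) (b - x) with h3 | h3 <;> linarith

/-- A continuous function whose mixed distributional derivative vanishes is additively split:
its alternating sum over the corners of any axis-parallel rectangle is zero. -/
theorem add_corners_eq_of_integral_mul_partialXY_eq_zero {g : ℝ × ℝ → ℝ} (hg : Continuous g)
    (h : ∀ φ, IsTest φ → ∫ p, g p * partialXY φ p = 0) (a b c d : ℝ) :
    g (a, c) + g (b, d) = g (a, d) + g (b, c) := by
  suffices H : ∀ ε > 0, |g (a, c) + g (b, d) - (g (a, d) + g (b, c))| ≤ 4 * ε by
    refine sub_eq_zero.mp (abs_eq_zero.mp (le_antisymm (le_of_forall_pos_le_add ?_) (abs_nonneg _)))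
    intro ε hε
    have := H (ε / 4) (by positivity)
    linarith
  intro ε hε
  have hnhds : ∀ q : ℝ × ℝ, ∃ δ > 0, ∀ p, dist p q < δ → dist (g p) (g q) < ε :=
    fun q => Metric.continuous_iff.mp hg q ε hε
  choose δ hδ hgδ using hnhds
  obtain ⟨r, hr, hr1, hr2, hr3, hr4⟩ : ∃ r > 0, r ≤ δ (a, c) ∧ r ≤ δ (b, d) ∧
      r ≤ δ (a, d) ∧ r ≤ δ (b, c) :=
    ⟨min (min (δ (a, c)) (δ (b, d))) (min (δ (a, d)) (δ (b, c))),
      lt_min (lt_min (hδ _) (hδ _)) (lt_min (hδ _) (hδ _)), by simp, by simp, by simp, by simp⟩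
  let B : ContDiffBump (0 : ℝ) := ⟨r / 2, r, by positivity, by linarith⟩
  set ρ : ℝ → ℝ := B.normed volume
  have hρ : ContDiff ℝ (⊤ : ℕ∞) ρ := B.contDiff_normed
  have hρc : HasCompactSupport ρ := B.hasCompactSupport_normed
  have hρs : Function.support ρ = Metric.ball 0 r := B.support_normed_eq
  have hmean : ∀ q : ℝ × ℝ, r ≤ δ q →
      |(∫ p : ℝ × ℝ, (ρ (q.1 - p.1) * ρ (q.2 - p.2)) * g p) - g q| ≤ ε := by
    intro q hq
    have key := dist_convolution_le (μ := (volume : Measure (ℝ × ℝ)))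
      (f := fun p : ℝ × ℝ => ρ p.1 * ρ p.2) (g := g) (x₀ := q) (R := r) (z₀ := g q) hε.le
      (by
        intro p hp
        rw [Function.mem_support, mul_ne_zero_iff] at hp
        have h1 : p.1 ∈ Metric.ball (0 : ℝ) r := hρs ▸ hp.1
        have h2 : p.2 ∈ Metric.ball (0 : ℝ) r := hρs ▸ hp.2
        rw [Metric.mem_ball] at h1 h2 ⊢
        rw [Prod.dist_eq]
        exact max_lt h1 h2)
      (fun p => mul_nonneg (B.nonneg_normed _) (B.nonneg_normed _))
      (by
        rw [Measure.volume_eq_prod, integral_prod_mul, B.integral_normed, one_mul])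
      hg.aestronglyMeasurable
      (fun p hp => (hgδ q p (lt_of_lt_of_le hp hq)).le)
    rw [convolution_eq_swap, Real.dist_eq] at key
    simpa using key
  have hint : ∀ s t : ℝ, Integrable fun p : ℝ × ℝ => (ρ (s - p.1) * ρ (t - p.2)) * g p := by
    intro s t
    refine Continuous.integrable_of_hasCompactSupport (by fun_prop) ?_
    refine HasCompactSupport.mul_right ?_
    refine HasCompactSupport.intro
      (K := Metric.closedBall s r ×ˢ Metric.closedBall t r)
      ((isCompact_closedBall s r).prod (isCompact_closedBall t r)) fun p hp => ?_
    by_contra hne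
    rw [mul_eq_zero, not_or] at hne
    have h1 : s - p.1 ∈ Metric.ball (0 : ℝ) r := hρs ▸ hne.1
    have h2 : t - p.2 ∈ Metric.ball (0 : ℝ) r := hρs ▸ hne.2
    rw [mem_ball_zero_iff] at h1 h2
    refine hp ⟨?_, ?_⟩
    · rw [Metric.mem_closedBall', dist_eq_norm]; exact h1.le
    · rw [Metric.mem_closedBall', dist_eq_norm]; exact h2.le
  obtain ⟨A, hA, hAc, hAd⟩ := exists_antideriv_sub_translate hρ hρc a b
  obtain ⟨C, hC, hCc, hCd⟩ := exists_antideriv_sub_translate hρ hρc c d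
  have htest : IsTest fun p : ℝ × ℝ => A p.1 * C p.2 := by
    refine ⟨by fun_prop, HasCompactSupport.intro
      (K := tsupport A ×ˢ tsupport C) (hAc.isCompact.prod hCc.isCompact) fun p hp => ?_⟩
    by_contra hne
    rw [mul_eq_zero, not_or] at hne
    exact hp ⟨subset_tsupport A hne.1, subset_tsupport C hne.2⟩
  have hzero := h _ htest
  have hexpand : ∀ p : ℝ × ℝ, g p * partialXY (fun p : ℝ × ℝ => A p.1 * C p.2) p =
      ((ρ (a - p.1) * ρ (c - p.2)) * g p + (ρ (b - p.1) * ρ (d - p.2)) * g p) -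
      ((ρ (a - p.1) * ρ (d - p.2)) * g p + (ρ (b - p.1) * ρ (c - p.2)) * g p) := by
    intro p
    simp only [partialXY, deriv_mul_const_field, deriv_const_mul_field, hAd, hCd]
    ring
  rw [integral_congr_ae (Filter.Eventually.of_forall hexpand),
    integral_sub ((hint _ _).fun_add (hint _ _)) ((hint _ _).fun_add (hint _ _)),
    integral_add (hint _ _) (hint _ _), integral_add (hint _ _) (hint _ _)] at hzero
  have e1 := abs_le.mp (hmean (a, c) hr1)
  have e2 := abs_le.mp (hmean (b, d) hr2)
  have e3 := abs_le.mp (hmean (a, d) hr3)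
  have e4 := abs_le.mp (hmean (b, c) hr4)
  rw [abs_le]
  constructor <;> linarith [e1.1, e1.2, e2.1, e2.2, e3.1, e3.2, e4.1, e4.2]

theorem stmt_16 (f : ℝ × ℝ → ℝ) (hf : Continuous f)
    (h1 : ∀ φ, IsTest φ → ∫ p, f p * partialXY φ p = 0)
    (h2 : ∀ φ, IsTest φ → ∫ p, (f p) ^ 2 * partialXY φ p = 0) :
    ∃ α β : ℝ → ℝ, Continuous α ∧ Continuous β ∧
      (∀ x y : ℝ, f (x, y) = α x + β y) ∧
      (∀ φ, IsTest φ → ∫ p : ℝ × ℝ, (α p.1 * β p.2) * partialXY φ p = 0) ∧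
      ((∃ c : ℝ, ∀ x, α x = c) ∨ (∃ c : ℝ, ∀ y, β y = c)) := by
  have hsplit := add_corners_eq_of_integral_mul_partialXY_eq_zero hf h1
  have hsplit_sq := add_corners_eq_of_integral_mul_partialXY_eq_zero (hf.pow 2) h2
  have hprod : ∀ x y, (f (x, 0) - f (0, 0)) * (f (0, y) - f (0, 0)) = 0 := by
    intro x y
    have e1 : f (x, y) = f (x, 0) + f (0, y) - f (0, 0) := by linarith [hsplit x 0 y 0]
    have e2 : f (x, y) ^ 2 + f (0, 0) ^ 2 = f (x, 0) ^ 2 + f (0, y) ^ 2 := hsplit_sq x 0 y 0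
    rw [e1] at e2
    linear_combination e2 / 2
  by_cases hα : ∀ x, f (x, 0) = f (0, 0)
  · refine ⟨fun _ => 0, fun y => f (0, y), by fun_prop, by fun_prop, fun x y => ?_,
      by simp, Or.inl ⟨0, fun _ => rfl⟩⟩
    linarith [hsplit x 0 y 0, hα x]
  · push Not at hα
    obtain ⟨x₀, hx₀⟩ := hα
    refine ⟨fun x => f (x, 0), fun _ => 0, by fun_prop, by fun_prop, fun x y => ?_,
      by simp, Or.inr ⟨0, fun _ => rfl⟩⟩
    have hy := (mul_eq_zero.mp (hprod x₀ y)).resolve_left (sub_ne_zero.mpr hx₀)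
    linarith [hsplit x 0 y 0]
end
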